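/- For Lebesgue-almost every X ∈ ℝ^{n×p} (identifying ℝ^{n×p} with ℝ^{np}), the following holds: for every y ∈ ℝⁿ and every λ > 0, the lasso problem has a unique solution, and this solution has at most min{n,p} nonzero components. -/

import Mathlib

open Matrix BigOperators Filter MeasureTheory

/-- The lasso criterion: (1/2)‖y − Xβ‖₂² + λ‖β‖₁. -/
noncomputable def lassoObj {n p : ℕ} (y : Fin n → ℝ) (X : Matrix (Fin n) (Fin p) ℝ)
    (lam : ℝ) (β : Fin p → ℝ) : ℝ :=
  (1 / 2) * ∑ j, (y j - X.mulVec β j) ^ 2 + lam * ∑ i, |β i|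

/-- A lasso solution: a minimizer of the lasso criterion. -/
def IsLassoSol {n p : ℕ} (y : Fin n → ℝ) (X : Matrix (Fin n) (Fin p) ℝ)
    (lam : ℝ) (b : Fin p → ℝ) : Prop :=
  ∀ β : Fin p → ℝ, lassoObj y X lam b ≤ lassoObj y X lam β

/-- Inner product of the i-th column of X with the residual y − Xb. -/
noncomputable def corr {n p : ℕ} (y : Fin n → ℝ) (X : Matrix (Fin n) (Fin p) ℝ)
    (b : Fin p → ℝ) (i : Fin p) : ℝ :=
  ∑ j, X j i * (y j - X.mulVec b j)

open Classical in
/-- The equicorrelation set E = {i : |X_iᵀ(y − Xb)| = λ}, defined from a solution b. -/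
noncomputable def equiSet {n p : ℕ} (y : Fin n → ℝ) (X : Matrix (Fin n) (Fin p) ℝ)
    (lam : ℝ) (b : Fin p → ℝ) : Finset (Fin p) :=
  Finset.univ.filter fun i => |corr y X b i| = lam

/-- The submatrix of X with columns indexed by E. -/
def colSub {n p : ℕ} (X : Matrix (Fin n) (Fin p) ℝ) (E : Finset (Fin p)) :
    Matrix (Fin n) E ℝ :=
  fun j i => X j i

lemma ae_ne_zero_of_line {E : Type*} [NormedAddCommGroup E] [NormedSpace ℝ E]
    [FiniteDimensional ℝ E] [MeasurableSpace E] [BorelSpace E] (μ : Measure E)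
    [μ.IsAddHaarMeasure] [SFinite μ] (F : E → ℝ) (hF : Continuous F) (x0 : E) (h0 : F x0 ≠ 0)
    (hP : ∀ x, ∃ P : Polynomial ℝ, ∀ t : ℝ, P.eval t = F (x0 + t • x)) :
    ∀ᵐ x ∂μ, F x ≠ 0 := by
  have hc : Continuous fun z : ℝ × E => F (x0 + z.1 • z.2) := by fun_prop
  have hcl : IsClosed {z : ℝ × E | F (x0 + z.1 • z.2) = 0} := isClosed_eq hc continuous_const
  have hc' : Continuous fun z : E × ℝ => F (x0 + z.2 • z.1) := by fun_prop
  have hcl' : IsClosed {z : E × ℝ | F (x0 + z.2 • z.1) = 0} := isClosed_eq hc' continuous_const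
  have h1 : ∀ᵐ z ∂(μ.prod (volume : Measure ℝ)), F (x0 + z.2 • z.1) ≠ 0 := by
    rw [Measure.ae_prod_iff_ae_ae (p := fun z : E × ℝ => F (x0 + z.2 • z.1) ≠ 0)
      hcl'.measurableSet.compl]
    refine Eventually.of_forall fun x => ?_
    obtain ⟨P, hPx⟩ := hP x
    have hP0 : P ≠ 0 := by
      rintro rfl
      have := hPx 0
      simp at this
      exact h0 this.symm
    have hfin : Set.Finite {t : ℝ | P.eval t = 0} := by
      refine (P.roots.toFinset.finite_toSet).subset fun t ht => ?_
      simp only [Finset.mem_coe, Multiset.mem_toFinset]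
      exact (Polynomial.mem_roots hP0).2 ht
    have := hfin.measure_zero (volume : Measure ℝ)
    rw [ae_iff]
    simpa [hPx] using this
  have h2 : ∀ᵐ z ∂((volume : Measure ℝ).prod μ), F (x0 + z.1 • z.2) ≠ 0 := by
    have := (Measure.measurePreserving_swap (μ := (volume : Measure ℝ)) (ν := μ)).quasiMeasurePreserving.ae h1
    simpa using this
  have h3 := Measure.ae_ae_of_ae_prod h2
  have h4 : ∀ᵐ t : ℝ, t ≠ 0 := Measure.ae_ne _ 0
  obtain ⟨t, ht, ht0⟩ := (h3.and h4).exists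
  rw [ae_iff] at ht ⊢
  have e : {x : E | ¬ F (x0 + t • x) ≠ 0} = (fun x => t • x) ⁻¹' ((fun x => x0 + x) ⁻¹' {x | ¬ F x ≠ 0}) := rfl
  rw [e, Measure.addHaar_preimage_smul μ ht0, measure_preimage_add] at ht
  rcases mul_eq_zero.1 ht with h | h
  · exfalso
    rw [ENNReal.ofReal_eq_zero] at h
    have h' : 0 < |(t ^ Module.finrank ℝ E)⁻¹| := abs_pos.2 (inv_ne_zero (pow_ne_zero _ ht0))
    linarith
  · exact h

/-- augmented matrix -/
def augM {n p k : ℕ} (A : Fin n → Fin p → ℝ) (f : Fin k → Fin p) (g : Fin k → Option (Fin n))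
    (s : Fin k → ℝ) : Matrix (Fin k) (Fin k) ℝ :=
  Matrix.of fun a b => (g a).elim (s b) fun i => A i (f b)

lemma augM_ae {n p k : ℕ} (f : Fin k → Fin p) (hf : f.Injective)
    (g : Fin k → Option (Fin n)) (hg : g.Injective) (s : Fin k → ℝ) (hs : ∀ a, s a ≠ 0) :
    ∀ᵐ A ∂(volume : Measure (Fin n → Fin p → ℝ)), (augM A f g s).det ≠ 0 := by
  classical
  refine ae_ne_zero_of_line volume (fun A => (augM A f g s).det) ?_
    (fun i j => if ∃ a, g a = some i ∧ f a = j then 1 else 0) ?_ ?_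
  · refine Continuous.matrix_det ?_
    refine continuous_matrix fun a b => ?_
    simp only [augM, Matrix.of_apply]
    cases g a <;> simp <;> fun_prop
  · have key : ∀ a b i, g a = some i → ((∃ a', g a' = some i ∧ f a' = f b) ↔ a = b) := by
      intro a b i h
      constructor
      · rintro ⟨a', h1, h2⟩
        rw [← hf h2]
        exact hg (h.trans h1.symm)
      · rintro rfl
        exact ⟨a, h, rfl⟩
    intro hdet
    obtain ⟨v, hv, hMv⟩ := Matrix.exists_mulVec_eq_zero_iff.2 hdet
    have hsome : ∀ a, g a ≠ none → v a = 0 := by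
      intro a ha
      obtain ⟨i, hi⟩ := Option.ne_none_iff_exists'.1 ha
      have := congrFun hMv a
      simpa [Matrix.mulVec, dotProduct, augM, hi, key a _ i hi] using this
    apply hv
    funext a
    by_cases ha : g a = none
    · have := congrFun hMv a
      simp only [Matrix.mulVec, dotProduct, augM, ha, Matrix.of_apply, Option.elim_none, Pi.zero_apply] at this
      rw [Finset.sum_eq_single a] at this
      · exact (mul_eq_zero.1 this).resolve_left (hs a)
      · intro b _ hb
        rw [hsome b (fun h => hb (hg (h.trans ha.symm))), mul_zero]
      · simp
    · exact hsome a ha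
  · intro A
    refine ⟨Matrix.det (Matrix.of fun a b => (g a).elim (Polynomial.C (s b)) fun i =>
      Polynomial.C (if ∃ a, g a = some i ∧ f a = f b then 1 else 0)
        + Polynomial.X * Polynomial.C (A i (f b))), fun t => ?_⟩
    rw [← Polynomial.coe_evalRingHom, RingHom.map_det]
    congr 1
    ext a b
    simp only [augM, RingHom.mapMatrix_apply, Matrix.map_apply, Matrix.of_apply]
    cases g a with
    | none => simp
    | some i => simp only [Option.elim_some, Pi.add_apply, Pi.smul_apply, smul_eq_mul,
        Polynomial.coe_evalRingHom, Polynomial.eval_add, Polynomial.eval_C,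
        Polynomial.eval_mul, Polynomial.eval_X]

lemma lasso_exists {n p : ℕ} (y : Fin n → ℝ) (X : Matrix (Fin n) (Fin p) ℝ) (lam : ℝ)
    (hl : 0 < lam) : ∃ b, IsLassoSol y X lam b := by
  have hc : Continuous (lassoObj y X lam) := by
    unfold lassoObj Matrix.mulVec dotProduct
    fun_prop
  refine hc.exists_forall_le ?_
  have h1 : Tendsto (fun β : Fin p → ℝ => lam * ‖β‖) (cocompact _) atTop :=
    (tendsto_norm_cocompact_atTop).const_mul_atTop hl
  refine tendsto_atTop_mono (fun β => ?_) h1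
  have h2 : ‖β‖ ≤ ∑ i, |β i| := by
    rw [pi_norm_le_iff_of_nonneg (by positivity)]
    intro i
    exact Finset.single_le_sum (f := fun i => |β i|) (fun _ _ => abs_nonneg _) (Finset.mem_univ i)
  have h3 : 0 ≤ (1 / 2) * ∑ j, (y j - X.mulVec β j) ^ 2 := by positivity
  unfold lassoObj
  nlinarith

lemma lasso_fit {n p : ℕ} (y : Fin n → ℝ) (X : Matrix (Fin n) (Fin p) ℝ) (lam : ℝ)
    (hl : 0 < lam) (b c : Fin p → ℝ) (hb : IsLassoSol y X lam b) (hc : IsLassoSol y X lam c) :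
    X.mulVec b = X.mulVec c := by
  have h1 := hb ((1/2 : ℝ) • (b + c))
  have h2 := hc ((1/2 : ℝ) • (b + c))
  have e : ∑ j, (y j - X.mulVec ((1/2 : ℝ) • (b + c)) j) ^ 2 =
      (1/2) * ∑ j, (y j - X.mulVec b j) ^ 2 + (1/2) * ∑ j, (y j - X.mulVec c j) ^ 2
       - (1/4) * ∑ j, (X.mulVec b j - X.mulVec c j) ^ 2 := by
    simp only [Finset.mul_sum, ← Finset.sum_add_distrib, ← Finset.sum_sub_distrib]
    refine Finset.sum_congr rfl fun j _ => ?_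
    rw [Matrix.mulVec_smul, Matrix.mulVec_add]
    simp only [Pi.smul_apply, Pi.add_apply, smul_eq_mul]
    ring
  have l : ∑ i, |((1/2 : ℝ) • (b + c)) i| ≤ (1/2) * ∑ i, |b i| + (1/2) * ∑ i, |c i| := by
    simp only [Finset.mul_sum, ← Finset.sum_add_distrib]
    refine Finset.sum_le_sum fun i _ => ?_
    simp only [Pi.smul_apply, Pi.add_apply, smul_eq_mul, abs_mul]
    have := abs_add_le (b i) (c i)
    rw [abs_of_pos (by norm_num : (0:ℝ) < 1/2)]
    linarith
  have l' := mul_le_mul_of_nonneg_left l hl.le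
  unfold lassoObj at h1 h2
  rw [e] at h1 h2
  have hz : ∑ j, (X.mulVec b j - X.mulVec c j) ^ 2 = 0 :=
    le_antisymm (by linarith) (by positivity)
  funext j
  have := (Finset.sum_eq_zero_iff_of_nonneg (fun _ _ => sq_nonneg _)).1 hz j (Finset.mem_univ j)
  exact sub_eq_zero.1 (pow_eq_zero_iff (by norm_num) |>.1 this)

lemma lasso_kkt {n p : ℕ} (y : Fin n → ℝ) (X : Matrix (Fin n) (Fin p) ℝ) (lam : ℝ)
    (hl : 0 < lam) (b : Fin p → ℝ) (hb : IsLassoSol y X lam b) (i : Fin p) (hi : b i ≠ 0) :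
    |corr y X b i| = lam := by
  set c := corr y X b i with hc
  set q := ∑ j, X j i ^ 2 with hq
  have hq0 : 0 ≤ q := by positivity
  have main : ∀ t : ℝ, 0 ≤ - t * c + t ^ 2 * q / 2 + lam * (|b i + t| - |b i|) := by
    intro t
    have h := hb (b + Pi.single i t)
    have e1 : ∑ j, (y j - X.mulVec (b + Pi.single i t) j) ^ 2 =
        ∑ j, (y j - X.mulVec b j) ^ 2 - 2 * t * c + t ^ 2 * q := by
      rw [hc, hq]
      unfold corr
      simp only [Finset.mul_sum, ← Finset.sum_add_distrib, ← Finset.sum_sub_distrib]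
      refine Finset.sum_congr rfl fun j _ => ?_
      rw [Matrix.mulVec_add]
      simp only [Pi.add_apply, Matrix.mulVec_single, Pi.smul_apply, Matrix.col_apply]
      simp
      ring
    have e2 : ∑ k, |(b + Pi.single i t : Fin p → ℝ) k| - ∑ k, |b k| = |b i + t| - |b i| := by
      rw [← Finset.sum_sub_distrib, Finset.sum_eq_single i]
      · simp
      · intro k _ hk
        simp [hk]
      · simp
    unfold lassoObj at h
    rw [e1] at h
    rw [← e2]
    linarith
  obtain ⟨σ, hσ, hσb⟩ : ∃ σ : ℝ, |σ| = 1 ∧ ∀ t, |t| ≤ |b i| → |b i + t| - |b i| = σ * t := by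
    rcases lt_or_gt_of_ne hi with h | h
    · refine ⟨-1, by simp, fun t ht => ?_⟩
      rw [abs_of_neg h] at *
      rw [abs_of_nonpos (by linarith [le_abs_self t])]
      ring
    · refine ⟨1, by simp, fun t ht => ?_⟩
      rw [abs_of_pos h] at *
      rw [abs_of_nonneg (by linarith [neg_abs_le t])]
      ring
  set d := lam * σ - c with hd
  have hd0 : d = 0 := by
    by_contra hne
    set ε := min (1 / (q + 1)) (|b i| / |d|) with hε
    have hdp : 0 < |d| := abs_pos.2 hne
    have hbp : 0 < |b i| := abs_pos.2 hi
    have hε0 : 0 < ε := lt_min (by positivity) (by positivity)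
    have h1 : ε * (q + 1) ≤ 1 := by
      rw [← le_div_iff₀ (by positivity)]; exact min_le_left _ _
    have h2 : ε * |d| ≤ |b i| := by
      rw [← le_div_iff₀ hdp]; exact min_le_right _ _
    have h3 := main (-ε * d)
    rw [hσb (-ε * d) (by rw [abs_mul, abs_neg, abs_of_pos hε0]; exact h2)] at h3
    have h4 : 0 ≤ (ε * d ^ 2) * (- 1 + ε * q / 2) := by
      have : (ε * d ^ 2) * (- 1 + ε * q / 2) = - (-ε * d) * c + (-ε * d) ^ 2 * q / 2 + lam * (σ * (-ε * d)) := by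
        rw [hd]; ring
      rw [this]; exact h3
    have h5 : 0 < ε * d ^ 2 := by positivity
    have h6 := nonneg_of_mul_nonneg_right h4 h5
    nlinarith [mul_nonneg hε0.le hq0]
  have : c = lam * σ := by linarith
  rw [this, abs_mul, hσ, abs_of_pos hl, mul_one]

/-- the sign pattern vectors -/
def sgnV {k : ℕ} (s : Fin k → Bool) : Fin k → ℝ := fun a => if s a then 1 else -1

lemma equi_card {n p : ℕ} (A : Fin n → Fin p → ℝ)
    (hA : ∀ k ≤ n + 1, ∀ (f : Fin k → Fin p) (g : Fin k → Option (Fin n)) (s : Fin k → Bool),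
      f.Injective → g.Injective → (augM A f g (sgnV s)).det ≠ 0)
    (y : Fin n → ℝ) (lam : ℝ) (hl : 0 < lam) (b : Fin p → ℝ) :
    (equiSet y (Matrix.of A) lam b).card ≤ n := by
  by_contra hcon
  push Not at hcon
  obtain ⟨T, hT, hcard⟩ := Finset.exists_subset_card_eq (Nat.succ_le_of_lt hcon)
  let f : Fin (n + 1) → Fin p := fun a => (T.equivFinOfCardEq hcard).symm a
  have hf : f.Injective := Subtype.val_injective.comp (Equiv.injective _)
  have hfE : ∀ a, |corr y (Matrix.of A) b (f a)| = lam := by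
    intro a
    have := hT ((T.equivFinOfCardEq hcard).symm a).2
    simpa [equiSet] using this
  let g : Fin (n + 1) ≃ Option (Fin n) := finSuccEquiv n
  let s : Fin (n + 1) → Bool := fun a => decide (0 ≤ corr y (Matrix.of A) b (f a))
  have hs : ∀ a, lam * sgnV s a = corr y (Matrix.of A) b (f a) := by
    intro a
    have := hfE a
    by_cases h : 0 ≤ corr y (Matrix.of A) b (f a)
    · rw [abs_of_nonneg h] at this
      simp [sgnV, s, this]
      intro h'
      linarith
    · rw [abs_of_neg (not_le.1 h)] at this
      simp [sgnV, s, h]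
      linarith
  refine hA (n + 1) le_rfl f g s hf g.injective ?_
  refine Matrix.exists_vecMul_eq_zero_iff.1
    ⟨fun a => (g a).elim (-lam) fun j => y j - (Matrix.of A).mulVec b j, ?_, ?_⟩
  · intro h
    have := congrFun h (g.symm none)
    simp at this
    linarith
  · funext c
    simp only [Matrix.vecMul, dotProduct, augM, Matrix.of_apply, Pi.zero_apply]
    rw [Equiv.sum_comp g (fun o => (o.elim (-lam) fun j => y j - (Matrix.of A).mulVec b j) *
      (o.elim (sgnV s c) fun i => A i (f c)))]
    rw [Fintype.sum_option]
    simp only [Option.elim_none, Option.elim_some]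
    rw [neg_mul, hs c, corr, neg_add_eq_zero]
    refine Finset.sum_congr rfl fun j _ => ?_
    simp [mul_comm]

lemma equi_indep {n p : ℕ} (A : Fin n → Fin p → ℝ)
    (hA : ∀ k ≤ n + 1, ∀ (f : Fin k → Fin p) (g : Fin k → Option (Fin n)) (s : Fin k → Bool),
      f.Injective → g.Injective → (augM A f g (sgnV s)).det ≠ 0)
    (T : Finset (Fin p)) (hT : T.card ≤ n) (c : Fin p → ℝ) (hc : ∀ i, i ∉ T → c i = 0)
    (h : (Matrix.of A).mulVec c = 0) : c = 0 := by
  let e := T.equivFin.symm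
  let f : Fin T.card → Fin p := fun a => e a
  have hf : f.Injective := Subtype.val_injective.comp (Equiv.injective _)
  let g : Fin T.card → Option (Fin n) := fun a => some (Fin.castLE hT a)
  have hg : g.Injective := (Option.some_injective _).comp (Fin.castLE_injective hT)
  have hd := hA T.card (by omega) f g (fun _ => true) hf hg
  have hz : (fun a => c (f a)) = 0 := by
    refine Matrix.eq_zero_of_mulVec_eq_zero hd ?_
    funext a
    have := congrFun h (Fin.castLE hT a)
    simp only [Matrix.mulVec, dotProduct, augM, Matrix.of_apply, Pi.zero_apply, g,
      Option.elim_some] at this ⊢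
    rw [← this]
    rw [Equiv.sum_comp e (fun i : T => A (Fin.castLE hT a) i * c i)]
    rw [Finset.sum_coe_sort T (fun i => A (Fin.castLE hT a) i * c i)]
    refine Finset.sum_subset (Finset.subset_univ _) fun i _ hi => ?_
    rw [hc i hi, mul_zero]
  funext i
  by_cases hi : i ∈ T
  · have := congrFun hz (e.symm ⟨i, hi⟩)
    simpa [f] using this
  · exact hc i hi

/-- For Lebesgue-almost every X, for every y and λ > 0 the lasso
problem has a unique solution, which has at most min{n,p} nonzero components. -/
theorem stmt8 {n p : ℕ} :
    ∀ᵐ A ∂(volume : Measure (Fin n → Fin p → ℝ)),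
      ∀ (y : Fin n → ℝ) (lam : ℝ), 0 < lam →
        (∃! b : Fin p → ℝ, IsLassoSol y (Matrix.of A) lam b) ∧
        ∀ b : Fin p → ℝ, IsLassoSol y (Matrix.of A) lam b →
          {i : Fin p | b i ≠ 0}.ncard ≤ min n p := by
  have hae : ∀ᵐ A ∂(volume : Measure (Fin n → Fin p → ℝ)),
      ∀ k ≤ n + 1, ∀ (f : Fin k → Fin p) (g : Fin k → Option (Fin n)) (s : Fin k → Bool),
      f.Injective → g.Injective → (augM A f g (sgnV s)).det ≠ 0 := by
    simp only [ae_all_iff, eventually_all]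
    intro k _ f g s hf hg
    refine augM_ae f hf g hg _ fun a => ?_
    unfold sgnV
    split_ifs <;> norm_num
  filter_upwards [hae] with A hA y lam hl
  have hsub : ∀ b, IsLassoSol y (Matrix.of A) lam b → ∀ i, b i ≠ 0 →
      i ∈ equiSet y (Matrix.of A) lam b := by
    intro b hb i hi
    simpa [equiSet] using lasso_kkt y (Matrix.of A) lam hl b hb i hi
  refine ⟨?_, fun b hb => ?_⟩
  · obtain ⟨b, hb⟩ := lasso_exists y (Matrix.of A) lam hl
    refine ⟨b, hb, fun c hc => ?_⟩
    have hfit := lasso_fit y (Matrix.of A) lam hl c b hc hb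
    have hE : equiSet y (Matrix.of A) lam c = equiSet y (Matrix.of A) lam b := by
      unfold equiSet corr
      rw [hfit]
    have := equi_indep A hA _ (equi_card A hA y lam hl b) (c - b) (fun i hi => ?_) ?_
    · exact sub_eq_zero.1 this
    · have h1 : b i = 0 := by
        by_contra h
        exact hi (hsub b hb i h)
      have h2 : c i = 0 := by
        by_contra h
        exact hi (hE ▸ hsub c hc i h)
      simp [h1, h2]
    · rw [Matrix.mulVec_sub, hfit, sub_self]
  · refine le_min ?_ ?_
    · refine le_trans ?_ (equi_card A hA y lam hl b)
      rw [← Set.ncard_coe_finset]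
      exact Set.ncard_le_ncard (fun i hi => hsub b hb i hi) (Finset.finite_toSet _)
    · calc _ ≤ (Set.univ : Set (Fin p)).ncard := Set.ncard_le_ncard (Set.subset_univ _) Set.finite_univ
        _ = p := by simp [Set.ncard_univ]
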